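/- arXiv:1202.6112 — 2 statements merged into one kernel-verified Lean document; each statement's English description precedes it below -/
import Mathlib

section
/- For every real μ with 0 < μ < 1, the series Σ_{t=1}^{∞} t^{t−1}·(μ·e^{−μ})^{t}/(μ·t!) converges and its sum equals 1. -/
/-- Coefficients `t^{t-1}/t!` (with the value `1` at `t = 0`). -/
noncomputable def borelCoeff (t : ℕ) : ℝ := (t : ℝ) ^ (t - 1) / (t.factorial : ℝ)

lemma borelCoeff_nonneg (t : ℕ) : 0 ≤ borelCoeff t := by
  unfold borelCoeff; positivity

lemma borelCoeff_le (t : ℕ) : borelCoeff t ≤ Real.exp 1 ^ t := by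
  have h := Real.pow_div_factorial_le_exp (x := (t : ℝ)) (by positivity) t
  rw [← Real.exp_nat_mul, mul_one]
  refine le_trans ?_ h
  unfold borelCoeff
  rcases Nat.eq_zero_or_pos t with rfl | ht
  · simp
  · have : (1 : ℝ) ≤ t := by exact_mod_cast ht
    gcongr
    omega

lemma borel_summable {x : ℝ} (hx0 : 0 ≤ x) (hx : x * Real.exp 1 < 1) :
    Summable (fun t : ℕ => borelCoeff t * x ^ t) := by
  refine Summable.of_nonneg_of_le (fun t => mul_nonneg (borelCoeff_nonneg t) (by positivity))
    (fun t => ?_) (summable_geometric_of_lt_one (by positivity) hx)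
  rw [mul_pow, mul_comm]
  exact mul_le_mul_of_nonneg_left (borelCoeff_le t) (by positivity)

lemma borel_coeff_sum (x : ℝ) (n : ℕ) :
    ∑ p ∈ Finset.HasAntidiagonal.antidiagonal n,
      borelCoeff p.1 * x ^ p.1 * ((-(p.1 * x)) ^ p.2 / (p.2.factorial : ℝ))
      = if n = 0 then 1 else if n = 1 then x else 0 := by
  rcases n with _ | _ | n
  · simp [borelCoeff]
  · simp [Finset.Nat.antidiagonal_succ, borelCoeff]
  · have h := congrFun (fwdDiff_iter_pow_eq_zero_of_lt (R := ℝ) (j := n + 1) (n := n + 2)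
      (by omega)) 0
    rw [fwdDiff_iter_eq_sum_shift] at h
    rw [Finset.Nat.sum_antidiagonal_eq_sum_range_succ_mk]
    simp only [Pi.zero_apply] at h
    have h2 : ((x ^ (n + 2)) / ((n + 2).factorial : ℝ)) * 0 = 0 := mul_zero _
    rw [← h, Finset.mul_sum] at h2
    simp only [Nat.add_eq_zero_iff, one_ne_zero, and_false, if_false,
      Nat.succ_eq_add_one, Nat.add_eq_right]
    rw [show n + 1 + 1 = n + 2 from rfl]
    refine Eq.trans (Finset.sum_congr rfl fun t ht => ?_) (h2.trans h)
    have htn : t ≤ n + 2 := by have := Finset.mem_range.1 ht; omega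
    simp only [nsmul_eq_mul, mul_one, zero_add, zsmul_eq_mul]
    push_cast
    rw [Nat.cast_choose ℝ htn, neg_pow, mul_pow]
    unfold borelCoeff
    have e1 : x ^ (n + 2) = x ^ t * x ^ (n + 2 - t) := by rw [← pow_add]; congr 1; omega
    have e2 : (t : ℝ) ^ (n + 1) = (t : ℝ) ^ (t - 1) * (t : ℝ) ^ (n + 2 - t) := by
      rcases Nat.eq_zero_or_pos t with rfl | ht0
      · simp
      · rw [← pow_add]; congr 1; omega
    rw [e1, e2]
    have := Nat.factorial_ne_zero t
    have := Nat.factorial_ne_zero (n + 2)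
    have := Nat.factorial_ne_zero (n + 2 - t)
    field_simp

lemma borel_small {x : ℝ} (hx0 : 0 < x) (hx : x < 1 / 10) :
    ∑' t : ℕ, borelCoeff t * (x * Real.exp (-x)) ^ t = 1 + x := by
  have hexp : ∀ y : ℝ, HasSum (fun k : ℕ => y ^ k / (k.factorial : ℝ)) (Real.exp y) := fun y => by
    rw [Real.exp_eq_exp_ℝ]; exact NormedSpace.expSeries_div_hasSum_exp y
  set f : ℕ × ℕ → ℝ := fun p =>
    borelCoeff p.1 * x ^ p.1 * ((-(p.1 * x)) ^ p.2 / (p.2.factorial : ℝ)) with hf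
  have hfs : Summable f := by
    rw [← summable_norm_iff]
    have hn : (fun p => ‖f p‖) = fun p : ℕ × ℕ =>
        borelCoeff p.1 * x ^ p.1 * ((p.1 * x) ^ p.2 / (p.2.factorial : ℝ)) := by
      funext p
      simp [hf, abs_mul, abs_div, abs_of_nonneg (borelCoeff_nonneg p.1), abs_of_pos hx0]
    rw [hn, summable_prod_of_nonneg]
    · refine ⟨fun t => ((hexp (t * x)).mul_left (borelCoeff t * x ^ t)).summable, ?_⟩
      have hs : Summable (fun t : ℕ => borelCoeff t * (x * Real.exp x) ^ t) := by
        apply borel_summable (by positivity)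
        have h1 : Real.exp x ≤ Real.exp 1 := Real.exp_le_exp.2 (by linarith)
        have h2 := Real.exp_one_lt_d9
        have h3 := Real.exp_pos x
        have h4 := Real.exp_pos 1
        calc x * Real.exp x * Real.exp 1 ≤ (1 / 10) * 2.7182818286 * 2.7182818286 := by
              gcongr
              linarith
          _ < 1 := by norm_num
      refine hs.congr fun t => ?_
      rw [((hexp (t * x)).mul_left (borelCoeff t * x ^ t)).tsum_eq, mul_pow, Real.exp_nat_mul]
      ring
    · intro p
      exact mul_nonneg (mul_nonneg (borelCoeff_nonneg _) (by positivity)) (by positivity)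
  have h1 : ∑' p, f p = ∑' t : ℕ, borelCoeff t * (x * Real.exp (-x)) ^ t := by
    rw [hfs.tsum_prod]
    refine tsum_congr fun t => ?_
    rw [((hexp (-(t * x))).mul_left (borelCoeff t * x ^ t)).tsum_eq, mul_pow, ← Real.exp_nat_mul]
    ring_nf
  rw [← h1, ← Finset.HasAntidiagonal.sigmaAntidiagonalEquivProd.tsum_eq f]
  have hs2 := Finset.HasAntidiagonal.sigmaAntidiagonalEquivProd.summable_iff.2 hfs
  rw [show (∑' c, f (Finset.HasAntidiagonal.sigmaAntidiagonalEquivProd c)) = ∑' c, (f ∘ Finset.HasAntidiagonal.sigmaAntidiagonalEquivProd) c from rfl, hs2.tsum_sigma]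
  have h3 : ∀ n : ℕ, (∑' c : Finset.HasAntidiagonal.antidiagonal n,
      (f ∘ Finset.HasAntidiagonal.sigmaAntidiagonalEquivProd) ⟨n, c⟩)
      = if n = 0 then 1 else if n = 1 then x else 0 := fun n => by
    rw [← borel_coeff_sum x n, tsum_fintype]
    exact Finset.sum_coe_sort (Finset.HasAntidiagonal.antidiagonal n) f
  rw [tsum_congr h3, tsum_eq_sum (s := Finset.range 2)]
  · simp [Finset.sum_range_succ]
  · intro n hn
    simp only [Finset.mem_range, not_lt] at hn
    rw [if_neg (by omega), if_neg (by omega)]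

lemma borel_arg {x : ℝ} (hx : x ∈ Set.Ioo (0 : ℝ) 1) : x * Real.exp (-x) * Real.exp 1 < 1 := by
  have h := Real.add_one_lt_exp (x := x - 1) (by have := hx.2; intro h; linarith)
  rw [mul_assoc, ← Real.exp_add]
  calc x * Real.exp (-x + 1) < Real.exp (x - 1) * Real.exp (-x + 1) := by
        gcongr; linarith
    _ = 1 := by rw [← Real.exp_add]; simp

lemma borel_analytic {y : ℝ} (hy0 : 0 ≤ y) (hy : y * Real.exp 1 < 1) :
    AnalyticAt ℝ (fun z : ℝ => ∑' t : ℕ, borelCoeff t * z ^ t) y := by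
  set p := FormalMultilinearSeries.ofScalars ℝ borelCoeff with hp
  let r : NNReal := ⟨Real.exp (-1), (Real.exp_pos _).le⟩
  have hr : (r : ENNReal) ≤ p.radius := by
    apply p.le_radius_of_bound 1
    intro n
    rw [hp, FormalMultilinearSeries.ofScalars_norm, Real.norm_of_nonneg (borelCoeff_nonneg n)]
    calc borelCoeff n * Real.exp (-1) ^ n ≤ Real.exp 1 ^ n * Real.exp (-1) ^ n := by
          gcongr; exact borelCoeff_le n
      _ = 1 := by rw [← mul_pow, ← Real.exp_add]; simp
  have hr0 : (0 : ENNReal) < r := by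
    rw [ENNReal.coe_pos]; exact Real.exp_pos (-1)
  have hb := p.hasFPowerSeriesOnBall (hr0.trans_le hr)
  have hsum : p.sum = fun z : ℝ => ∑' t : ℕ, borelCoeff t * z ^ t := by
    funext z
    have := FormalMultilinearSeries.ofScalars_sum_eq (E := ℝ) borelCoeff z
    simpa [FormalMultilinearSeries.ofScalarsSum] using this
  rw [← hsum]
  refine hb.analyticAt_of_mem ?_
  refine Metric.eball_subset_eball hr ?_
  rw [Metric.eball_coe, Metric.mem_ball, dist_zero_right, Real.norm_of_nonneg hy0]
  change y < Real.exp (-1)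
  rw [Real.exp_neg, ← one_div, lt_div_iff₀ (Real.exp_pos 1)]
  exact hy

lemma borel_gen {x : ℝ} (hx : x ∈ Set.Ioo (0 : ℝ) 1) :
    ∑' t : ℕ, borelCoeff t * (x * Real.exp (-x)) ^ t = 1 + x := by
  have hf : AnalyticOnNhd ℝ (fun x : ℝ => ∑' t : ℕ, borelCoeff t * (x * Real.exp (-x)) ^ t)
      (Set.Ioo (0 : ℝ) 1) := by
    intro y hy
    have h1 : AnalyticAt ℝ (fun x : ℝ => x * Real.exp (-x)) y := by fun_prop
    exact AnalyticAt.fun_comp (g := fun z : ℝ => ∑' t : ℕ, borelCoeff t * z ^ t)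
      (f := fun x : ℝ => x * Real.exp (-x))
      (borel_analytic (mul_nonneg hy.1.le (Real.exp_pos _).le) (borel_arg hy)) h1
  have hg : AnalyticOnNhd ℝ (fun x : ℝ => 1 + x) (Set.Ioo (0 : ℝ) 1) := by
    intro y _
    fun_prop
  refine hf.eqOn_of_preconnected_of_eventuallyEq hg isPreconnected_Ioo
    (z₀ := 1 / 20) (by norm_num) ?_ hx
  filter_upwards [Ioo_mem_nhds (a := (0 : ℝ)) (b := 1 / 10) (x := 1 / 20)
    (by norm_num) (by norm_num)] with z hz
  exact borel_small hz.1 hz.2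

/-- The Borel(μ) weights `t^{t−1}(μe^{−μ})^t/(μ·t!)`, `t ≥ 1`, form a probability
distribution: the series converges with sum `1`, for every `0 < μ < 1`. -/
theorem borel_sums_to_one (mu : ℝ) (hmu : mu ∈ Set.Ioo (0 : ℝ) 1) :
    Summable (fun t : ℕ+ => ((t : ℕ) : ℝ) ^ ((t : ℕ) - 1)
        * (mu * Real.exp (-mu)) ^ (t : ℕ) / (mu * ((t : ℕ).factorial : ℝ))) ∧
      ∑' t : ℕ+, ((t : ℕ) : ℝ) ^ ((t : ℕ) - 1)
        * (mu * Real.exp (-mu)) ^ (t : ℕ) / (mu * ((t : ℕ).factorial : ℝ)) = 1 := by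
  obtain ⟨h0, h1⟩ := hmu
  have hs := borel_summable (x := mu * Real.exp (-mu))
    (mul_nonneg h0.le (Real.exp_pos _).le) (borel_arg ⟨h0, h1⟩)
  have hh := hs.hasSum
  rw [borel_gen ⟨h0, h1⟩, ← hasSum_nat_add_iff' 1] at hh
  simp only [Finset.sum_range_one] at hh
  have h2 := (hasSum_pnat_iff_hasSum_succ
    (f := fun t : ℕ => borelCoeff t * (mu * Real.exp (-mu)) ^ t)).2 hh
  have h3 := h2.div_const mu
  have e : (1 + mu - borelCoeff 0 * (mu * Real.exp (-mu)) ^ 0) / mu = 1 := by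
    simp [borelCoeff, h0.ne']
  rw [e] at h3
  have h4 : HasSum (fun t : ℕ+ => ((t : ℕ) : ℝ) ^ ((t : ℕ) - 1)
        * (mu * Real.exp (-mu)) ^ (t : ℕ) / (mu * ((t : ℕ).factorial : ℝ))) 1 := by
    refine h3.congr_fun fun t => ?_
    unfold borelCoeff
    have := Nat.factorial_ne_zero (t : ℕ)
    field_simp
  exact ⟨h4.summable, h4.tsum_eq⟩
end

section
/- Let λ > 1 with conjugate μ ∈ (0,1) (i.e. μ·e^{−μ} = λ·e^{−λ}) and fix M > 0. There exist a constant δ' > 0 and N ∈ ℕ such that for all n ≥ N and all positive integers n₁, n₂ with |n₁ − (1−μ)(1−μ/λ)n| ≤ M√n and |n₂ − μ(1−μ/λ)n| ≤ M√n, the following holds: if X_1, …, X_{n₁} are i.i.d. random variables with P(X_i = t) = t^{t−1}(μe^{−μ})^t/(μ·t!) for every integer t ≥ 1, then P(X_1 + ⋯ + X_{n₁} = n₁ + n₂) ≥ δ'/√n. -/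
open MeasureTheory

noncomputable def abelA : ℕ → ℝ → ℝ
  | 0, _ => 1
  | n+1, x => x * (x + (n+1))^n / (n+1).factorial

lemma abelA_zero (n : ℕ) : abelA n 0 = if n = 0 then 1 else 0 := by
  cases n <;> simp [abelA]

lemma abelA_deriv (n : ℕ) (x : ℝ) : HasDerivAt (abelA (n+1)) (abelA n (x+1)) x := by
  have h : HasDerivAt (fun x : ℝ => x * (x + ((n:ℝ)+1))^n / ((n+1).factorial : ℝ))
      ((1 * (x + ((n:ℝ)+1))^n + x * ((n:ℝ) * (x + ((n:ℝ)+1))^(n-1) * 1)) / ((n+1).factorial : ℝ)) x := by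
    exact (((hasDerivAt_id x).mul (((hasDerivAt_id x).add_const ((n:ℝ)+1)).pow n))).div_const _
  have h2 : abelA (n+1) = (fun x : ℝ => x * (x + ((n:ℝ)+1))^n / ((n+1).factorial : ℝ)) := by
    funext x; simp [abelA]
  rw [h2]
  convert h using 1
  cases n with
  | zero => simp [abelA]
  | succ k =>
    have : ((k+1).factorial : ℝ) ≠ 0 := by positivity
    rw [Nat.factorial_succ (k+1)]
    simp only [abelA, Nat.add_sub_cancel]
    push_cast
    have h3 : (k:ℝ) + 1 + 1 ≠ 0 := by positivity
    field_simp
    ring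

lemma abelA_conv (n : ℕ) : ∀ x y : ℝ,
    ∑ p ∈ Finset.HasAntidiagonal.antidiagonal n, abelA p.1 x * abelA p.2 y = abelA n (x + y) := by
  induction n with
  | zero => intro x y; simp [abelA]
  | succ n ih =>
    intro x y
    have hd : ∀ x, HasDerivAt (fun x => ∑ p ∈ Finset.HasAntidiagonal.antidiagonal (n+1), abelA p.1 x * abelA p.2 y - abelA (n+1) (x + y)) 0 x := by
      intro x
      have e : (fun x => ∑ p ∈ Finset.HasAntidiagonal.antidiagonal (n+1), abelA p.1 x * abelA p.2 y - abelA (n+1) (x + y))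
        = fun x => (abelA (n+1) y + ∑ p ∈ Finset.HasAntidiagonal.antidiagonal n, abelA (p.1+1) x * abelA p.2 y) - abelA (n+1) (x + y) := by
        funext x
        rw [Finset.Nat.sum_antidiagonal_succ]
        simp [abelA]
      rw [e]
      have h1 : HasDerivAt (fun x => ∑ p ∈ Finset.HasAntidiagonal.antidiagonal n, abelA (p.1+1) x * abelA p.2 y)
          (∑ p ∈ Finset.HasAntidiagonal.antidiagonal n, abelA p.1 (x+1) * abelA p.2 y) x :=
        HasDerivAt.fun_sum fun p _ => (abelA_deriv p.1 x).mul_const _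
      have h2 : HasDerivAt (fun x => abelA (n+1) (x + y)) (abelA n (x + y + 1)) x :=
        (abelA_deriv n (x+y)).comp_add_const x y
      have := (h1.const_add (abelA (n+1) y)).sub h2
      rw [ih, show x + 1 + y = x + y + 1 by ring, sub_self] at this
      exact this
    have hc := is_const_of_deriv_eq_zero (fun x => (hd x).differentiableAt) (fun x => (hd x).deriv) x 0
    have h0 : ∑ p ∈ Finset.HasAntidiagonal.antidiagonal (n+1), abelA p.1 0 * abelA p.2 y = abelA (n+1) (0 + y) := by
      rw [Finset.Nat.sum_antidiagonal_succ]
      simp [abelA]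
    simp only [h0, sub_self] at hc
    linarith

lemma borel_pow_coeff (mu : ℝ) (k r : ℕ) :
    PowerSeries.coeff r ((PowerSeries.mk fun j : ℕ => abelA j 1 * mu ^ j * Real.exp (-mu) ^ (1 + j)) ^ k)
      = abelA r k * mu ^ r * Real.exp (-mu) ^ (k + r) := by
  induction k generalizing r with
  | zero => 
    simp only [pow_zero, PowerSeries.coeff_one, Nat.cast_zero, abelA_zero]
    split_ifs with h <;> simp [h]
  | succ k ih =>
    rw [pow_succ, PowerSeries.coeff_mul]
    push_cast
    rw [← abelA_conv, Finset.sum_mul, Finset.sum_mul]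
    apply Finset.sum_congr rfl
    intro p hp
    rw [Finset.HasAntidiagonal.mem_antidiagonal] at hp
    rw [ih, PowerSeries.coeff_mk, ← hp]
    ring

lemma borel_pow_coeff' (mu : ℝ) (hmu : 0 < mu) (k r : ℕ) :
    PowerSeries.coeff (k + r) ((PowerSeries.mk fun t : ℕ => if 1 ≤ t then
            (t : ℝ) ^ (t - 1) * (mu * Real.exp (-mu)) ^ t / (mu * (t.factorial : ℝ))
          else 0) ^ k)
      = abelA r k * mu ^ r * Real.exp (-mu) ^ (k + r) := by
  have : (PowerSeries.mk fun t : ℕ => if 1 ≤ t then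
            (t : ℝ) ^ (t - 1) * (mu * Real.exp (-mu)) ^ t / (mu * (t.factorial : ℝ))
          else 0) = PowerSeries.X * (PowerSeries.mk fun j : ℕ => abelA j 1 * mu ^ j * Real.exp (-mu) ^ (1 + j)) := by
    ext t
    cases t with
    | zero => simp
    | succ j =>
      rw [PowerSeries.coeff_succ_X_mul]
      simp only [PowerSeries.coeff_mk]
      cases j with
      | zero => simp [abelA]; field_simp
      | succ i =>
        simp only [abelA, Nat.factorial_succ]
        rw [if_pos (by omega)]
        have : (i.factorial : ℝ) ≠ 0 := by positivity
        have h3 : (i:ℝ) + 1 + 1 ≠ 0 := by positivity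
        have h4 : (i:ℝ) + 1 ≠ 0 := by positivity
        simp only [Nat.add_sub_cancel]
        push_cast
        field_simp
        ring
  rw [this, mul_pow, add_comm k r, PowerSeries.coeff_X_pow_mul, borel_pow_coeff, add_comm k r]

lemma measure_eq (X : PMF ℕ) (p : ℕ → ℝ) (hp : ∀ t, 0 ≤ p t) (hX : ∀ t, X t = ENNReal.ofReal (p t))
    (k m : ℕ) : ((Measure.pi fun _ : Fin k => X.toMeasure)
            {f : Fin k → ℕ | ∑ i, f i = m}).toReal = PowerSeries.coeff m (PowerSeries.mk p ^ k) := by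
  have hs : {f : Fin k → ℕ | ∑ i, f i = m} = ↑(Finset.piAntidiag (Finset.univ : Finset (Fin k)) m) := by
    ext f; simp
  rw [hs, ← MeasureTheory.sum_measure_singleton]
  have h1 : ∀ f : Fin k → ℕ, (Measure.pi fun _ : Fin k => X.toMeasure) {f} = ENNReal.ofReal (∏ i, p (f i)) := by
    intro f
    rw [Measure.pi_singleton, ENNReal.ofReal_prod_of_nonneg (fun i _ => hp _)]
    apply Finset.prod_congr rfl
    intro i _
    rw [PMF.toMeasure_apply_singleton _ _ (measurableSet_singleton _), hX]
  simp_rw [h1]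
  rw [← ENNReal.ofReal_sum_of_nonneg (fun f _ => Finset.prod_nonneg fun i _ => hp _),
    ENNReal.toReal_ofReal (Finset.sum_nonneg fun f _ => Finset.prod_nonneg fun i _ => hp _)]
  have h2 : PowerSeries.mk p ^ k = ∏ _i : Fin k, PowerSeries.mk p := by simp
  rw [h2, PowerSeries.coeff_prod]
  simp only [PowerSeries.coeff_mk]
  symm
  apply Finset.sum_bij (fun (l : Fin k →₀ ℕ) _ => (l : Fin k → ℕ))
  · intro l hl; simpa using hl
  · intro a _ b _ h; exact DFunLike.coe_injective h
  · intro f hf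
    refine ⟨Finsupp.equivFunOnFinite.symm f, ?_, ?_⟩
    · simpa using hf
    · simp
  · intros; rfl

lemma fact_le (n : ℕ) (hn : 0 < n) :
    (n.factorial : ℝ) ≤ Real.exp 1 * Real.sqrt n * (n / Real.exp 1) ^ n := by
  obtain ⟨j, rfl⟩ : ∃ j, n = j + 1 := ⟨n - 1, by omega⟩
  have h := Stirling.stirlingSeq'_antitone (Nat.zero_le j)
  simp only [Function.comp, Stirling.stirlingSeq_one, Nat.succ_eq_add_one, zero_add] at h
  rw [Stirling.stirlingSeq, div_le_iff₀ (by positivity)] at h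
  refine h.trans (le_of_eq ?_)
  rw [Real.sqrt_mul (by norm_num)]
  have : Real.sqrt 2 ≠ 0 := by positivity
  field_simp

lemma poisson_lower (x : ℝ) (hx : 0 < x) (n : ℕ) (hn : 0 < n) :
    Real.exp (-((x - n)^2 / x)) / (Real.exp 1 * Real.sqrt n) ≤ Real.exp (-x) * x ^ n / n.factorial := by
  have hn' : (0:ℝ) < n := by exact_mod_cast hn
  have h1 := fact_le n hn
  have h2 : Real.exp (-((x - n)^2 / x)) * (n / Real.exp 1) ^ n ≤ Real.exp (-x) * x ^ n := by
    have e1 : (n / Real.exp 1) ^ n = Real.exp (n * Real.log n - n) := by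
      rw [mul_comm, Real.exp_sub, div_pow, ← Real.exp_nat_mul, mul_one, mul_comm, Real.exp_nat_mul,
        Real.exp_log hn']
    have e2 : x ^ n = Real.exp (n * Real.log x) := by
      rw [Real.exp_nat_mul, Real.exp_log hx]
    rw [e1, e2, ← Real.exp_add, ← Real.exp_add, Real.exp_le_exp]
    have h3 := Real.log_le_sub_one_of_pos (div_pos hn' hx)
    rw [Real.log_div hn'.ne' hx.ne'] at h3
    have h4 := mul_le_mul_of_nonneg_left h3 hn'.le
    have e3 : (x - n)^2/x = x - 2 * n + n * (n / x) := by field_simp; ring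
    rw [e3]; linarith
  rw [div_le_div_iff₀ (by positivity) (by positivity)]
  calc _ ≤ Real.exp (-((x - n)^2 / x)) * (Real.exp 1 * Real.sqrt n * (n / Real.exp 1) ^ n) := by gcongr
    _ = (Real.exp (-((x - n)^2 / x)) * (n / Real.exp 1) ^ n) * (Real.exp 1 * Real.sqrt n) := by ring
    _ ≤ _ := by gcongr

set_option maxHeartbeats 1000000 in
/-- Estimate (eq-tilde-G-local) of the paper: the sum of `n₁` i.i.d. Borel(μ) variables
hits `n₁ + n₂` with probability at least `δ'/√n`, uniformly in the stated windows. -/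
theorem borel_sum_local_lower (lam mu : ℝ) (hlam : 1 < lam)
    (hmu : mu ∈ Set.Ioo (0 : ℝ) 1)
    (hconj : mu * Real.exp (-mu) = lam * Real.exp (-lam)) (M : ℝ) (hM : 0 < M) :
    ∃ δ' : ℝ, 0 < δ' ∧ ∃ N : ℕ, ∀ n : ℕ, N ≤ n → ∀ n₁ n₂ : ℕ, 0 < n₁ → 0 < n₂ →
      |(n₁ : ℝ) - (1 - mu) * (1 - mu / lam) * n| ≤ M * Real.sqrt n →
      |(n₂ : ℝ) - mu * (1 - mu / lam) * n| ≤ M * Real.sqrt n →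
      ∀ X : PMF ℕ,
        (∀ t : ℕ, X t = ENNReal.ofReal (if 1 ≤ t then
            (t : ℝ) ^ (t - 1) * (mu * Real.exp (-mu)) ^ t / (mu * (t.factorial : ℝ))
          else 0)) →
        δ' / Real.sqrt n ≤
          ((Measure.pi fun _ : Fin n₁ => X.toMeasure)
            {f : Fin n₁ → ℕ | ∑ i, f i = n₁ + n₂}).toReal := by
  obtain ⟨h0, h1⟩ := hmu
  obtain ⟨c, hc⟩ : ∃ c, c = 1 - mu / lam := ⟨_, rfl⟩
  have hml : mu / lam < 1 := by rw [div_lt_one (by linarith)]; linarith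
  have hml0 : 0 < mu / lam := by positivity
  have hc0 : 0 < c := by linarith
  have hc1 : c < 1 := by linarith
  have h1m : 0 < 1 - mu := by linarith
  rw [← hc]
  refine ⟨(1 - mu) / 4 * (Real.exp (-(2 * M^2/(mu * c))) / (2 * Real.exp 1)), by positivity,
    ⌈(4 * M / ((1 - mu) * c))^2⌉₊ + 1, ?_⟩
  intro n hn n₁ n₂ hn₁ hn₂ hA hB X hX
  rw [measure_eq X _ (by intro t; split_ifs <;> positivity) hX, borel_pow_coeff' mu h0]
  have hnpos : (0:ℝ) < n := by exact_mod_cast (by omega : 0 < n)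
  have hN : (4 * M / ((1 - mu) * c))^2 ≤ n := by
    refine (Nat.le_ceil _).trans ?_
    exact_mod_cast (by omega)
  obtain ⟨s, hs⟩ : ∃ s, s = Real.sqrt n := ⟨_, rfl⟩
  have hs0 : 0 < s := by rw [hs]; positivity
  have hss : s * s = n := by rw [hs]; exact Real.mul_self_sqrt hnpos.le
  have hsN : 4 * M / ((1 - mu) * c) ≤ s := by rw [hs]; exact Real.le_sqrt_of_sq_le hN
  rw [div_le_iff₀ (by positivity)] at hsN
  have hMs : 4 * (M * s) ≤ (1 - mu) * c * n := by
    rw [← hss]; nlinarith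
  rw [← hs] at hA hB ⊢
  have hcn : 0 < c * n := by positivity
  have hMs2 : 4 * (M * s) ≤ c * n := by nlinarith
  rw [abs_le] at hA hB
  obtain ⟨m, hm⟩ : ∃ m : ℝ, m = n₁ + n₂ := ⟨_, rfl⟩
  have hm1 : m ≤ 2 * (c * n) := by nlinarith
  have hm2 : c * n / 2 ≤ m := by nlinarith
  have hm0 : 0 < m := by linarith
  have hn₁l : (1 - mu) * (c * n) / 2 ≤ n₁ := by nlinarith
  have hratio : (1 - mu) / 4 ≤ n₁ / m := by
    rw [le_div_iff₀ hm0]; nlinarith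
  have heq : abelA n₂ n₁ * mu ^ n₂ * Real.exp (-mu) ^ (n₁ + n₂)
      = n₁ / m * (Real.exp (-(mu * m)) * (mu * m) ^ n₂ / n₂.factorial) := by
    have : Real.exp (-mu) ^ (n₁ + n₂) = Real.exp (-(mu * m)) := by
      rw [← Real.exp_nat_mul, hm]; push_cast; congr 1; ring
    rw [this]
    obtain ⟨j, rfl⟩ : ∃ j, n₂ = j + 1 := ⟨n₂ - 1, by omega⟩
    have hm' : (n₁:ℝ) + (j + 1) = m := by rw [hm]; push_cast; ring
    simp only [abelA, hm']
    field_simp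
    ring
  rw [heq]
  have hpl := poisson_lower (mu * m) (by positivity) n₂ hn₂
  have hsq : (mu * m - n₂)^2 ≤ M^2 * n := by
    have : |mu * m - n₂| ≤ M * s := by
      rw [abs_le, hm]; constructor <;> nlinarith
    have := sq_le_sq' (abs_le.1 this).1 (abs_le.1 this).2
    rw [← hss]; linarith
  have hex : (mu * m - n₂)^2 / (mu * m) ≤ 2 * M^2/(mu * c) := by
    rw [div_le_div_iff₀ (by positivity) (by positivity)]
    calc _ ≤ M^2 * n * (mu * c) := by gcongr
      _ = 2 * M^2 * (mu * (c * n / 2)) := by ring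
      _ ≤ _ := by gcongr
  have hn₁0 : (0:ℝ) ≤ n₁ := by positivity
  have hsqrt : Real.sqrt n₂ ≤ 2 * s := by
    apply Real.sqrt_le_iff.2 ⟨by positivity, ?_⟩
    nlinarith
  have hn₂0 : (0:ℝ) < n₂ := by exact_mod_cast hn₂
  calc _ = (1 - mu) / 4 * (Real.exp (-(2 * M^2/(mu * c))) / (Real.exp 1 * (2 * s))) := by
        field_simp
    _ ≤ n₁ / m * (Real.exp (-((mu * m - n₂)^2 / (mu * m))) / (Real.exp 1 * Real.sqrt n₂)) := by
        gcongr
    _ ≤ _ := by gcongr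
end
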